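/- (Unbiasedness of the variance-reduced token-level estimate ĝ₃) Suppose each conditional probability θ ↦ π_θ(v | y₁,…,y_{t−1}) is Fréchet differentiable at θ₀ and write π = π_{θ₀}. Then Σ_{y∈V^T} π(y) · Σ_{t=1}^T D_θ[log π_θ(y_t | y_{1:t−1})](θ₀) · ( log(π(y_t|y_{1:t−1})/π_ref(y_t|y_{1:t−1})) + Σ_{t'=t+1}^T KL(π(· | y_{1:t'−1}), π_ref(· | y_{1:t'−1})) ) = Σ_{y∈V^T} π(y) · log(π(y)/π_ref(y)) · Σ_{t=1}^T D_θ[log π_θ(y_t | y_{1:t−1})](θ₀), where KL(p,q) = Σ_{v∈V} p(v)·log(p(v)/q(v)) and π(y) = Π_{s=1}^T π(y_s | y_{1:s−1}). -/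

import Mathlib

open Finset

noncomputable section

/-- Sequence probability of an autoregressive policy given by its conditionals:
`π(y) = ∏_{s=1}^T π(y_s | y_{1:s-1})`. -/
def seqP {V : Type*} [Fintype V] {T : ℕ} (cond : List V → V → ℝ) (y : Fin T → V) : ℝ :=
  ∏ s : Fin T, cond ((List.ofFn y).take s.1) (y s)

/-- Token-level KL divergence between two distributions over the next token. -/
def KLtok {V : Type*} [Fintype V] (p q : V → ℝ) : ℝ :=
  ∑ v, p v * Real.log (p v / q v)

section helpers
variable {V : Type*} [Fintype V] {E : Type*} [AddCommGroup E] [Module ℝ E]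

lemma sum_cons_aux {T : ℕ} (f : (Fin (T+1) → V) → E) :
    ∑ y, f y = ∑ v, ∑ y : Fin T → V, f (Fin.cons v y) := by
  rw [← Fintype.sum_prod_type']
  exact (Fintype.sum_equiv (Fin.consEquiv (fun _ : Fin (T+1) => V)) _ _ (fun x => rfl)).symm

lemma seqP_cons_aux {T : ℕ} (c : List V → V → ℝ) (v : V) (y : Fin T → V) :
    seqP c (Fin.cons v y : Fin (T+1) → V) = c [] v * seqP (fun p => c (v :: p)) y := by
  simp [seqP, Fin.prod_univ_succ, List.ofFn_succ]

lemma seqP_sum_aux (T : ℕ) : ∀ (c : List V → V → ℝ) (_ : ∀ p, ∑ v, c p v = 1),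
    ∑ y : Fin T → V, seqP c y = 1 := by
  induction T with
  | zero => intro c hc; simp [seqP]
  | succ T ih =>
    intro c hc
    rw [sum_cons_aux]
    simp only [seqP_cons_aux, ← Finset.mul_sum]
    simp [ih (fun p => c (_ :: p)) (fun p => hc _), hc]

lemma expect_aux (T : ℕ) : ∀ (c : List V → V → ℝ) (_ : ∀ p, ∑ v, c p v = 1)
    (g : List V → V → E),
    ∑ y : Fin T → V, seqP c y • ∑ t : Fin T, g ((List.ofFn y).take t.1) (y t)
     = ∑ y : Fin T → V, seqP c y • ∑ t : Fin T,
        ∑ v, c ((List.ofFn y).take t.1) v • g ((List.ofFn y).take t.1) v := by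
  induction T with
  | zero => intro c hc g; simp
  | succ T ih =>
    intro c hc g
    rw [sum_cons_aux, sum_cons_aux]
    simp only [seqP_cons_aux, Fin.sum_univ_succ, List.ofFn_succ, Fin.cons_zero, Fin.cons_succ,
      Fin.val_zero, Fin.val_succ, List.take_zero, List.take_succ_cons, mul_smul, smul_add,
      Finset.sum_add_distrib, ← Finset.smul_sum]
    congr 1
    · simp only [← Finset.sum_smul, seqP_sum_aux T (fun p => c (_ :: p)) (fun p => hc _),
        one_smul, hc]
    · refine Finset.sum_congr rfl fun v _ => ?_
      rw [ih (fun p => c (v :: p)) (fun p => hc _) (fun p => g (v :: p))]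

lemma main_aux (T : ℕ) : ∀ (c : List V → V → ℝ) (_ : ∀ p, ∑ v, c p v = 1)
    (r : List V → V → ℝ) (s : List V → V → E) (_ : ∀ p, ∑ v, c p v • s p v = 0),
    ∑ y : Fin T → V, seqP c y • ∑ t : Fin T, (r ((List.ofFn y).take t.1) (y t)
        + ∑ t' : Fin T, if t < t' then
          ∑ v, c ((List.ofFn y).take t'.1) v * r ((List.ofFn y).take t'.1) v else 0) •
        s ((List.ofFn y).take t.1) (y t)
     = ∑ y : Fin T → V, seqP c y • (∑ t : Fin T, r ((List.ofFn y).take t.1) (y t)) •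
        ∑ t : Fin T, s ((List.ofFn y).take t.1) (y t) := by
  induction T with
  | zero => intro c hc r s hs; simp
  | succ T ih =>
    intro c hc r s hs
    rw [sum_cons_aux, sum_cons_aux]
    refine Finset.sum_congr rfl fun v _ => ?_
    have h1 := ih (fun p => c (v :: p)) (fun p => hc _) (fun p => r (v :: p))
      (fun p => s (v :: p)) (fun p => hs _)
    have h2 := expect_aux T (fun p => c (v :: p)) (fun p => hc _) (fun p => r (v :: p))
    have h3 := expect_aux T (fun p => c (v :: p)) (fun p => hc _) (fun p => s (v :: p))
    simp only [hs, Finset.sum_const_zero, smul_zero] at h3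
    simp only [smul_eq_mul] at h2
    simp only [seqP_cons_aux, Fin.sum_univ_succ, List.ofFn_succ, Fin.cons_zero, Fin.cons_succ,
      Fin.val_zero, Fin.val_succ, List.take_zero, List.take_succ_cons, mul_smul,
      ← Finset.smul_sum, Fin.succ_lt_succ_iff, Fin.succ_pos, if_true, lt_irrefl, if_false,
      Fin.not_lt_zero, zero_add]
    congr 1
    simp only [smul_add, add_smul, Finset.sum_add_distrib] at h1 ⊢
    rw [h1]
    have e1 : ∀ (F : (Fin T → V) → ℝ) (x : E), ∑ y, seqP (fun p => c (v :: p)) y • F y • x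
        = (∑ y, seqP (fun p => c (v :: p)) y * F y) • x := by
      intro F x
      rw [Finset.sum_smul]
      simp only [mul_smul]
    have e2 : ∑ y : Fin T → V, seqP (fun p => c (v :: p)) y • r [] v •
        ∑ t : Fin T, s (v :: (List.ofFn y).take t.1) (y t) = 0 := by
      simp only [smul_comm _ (r [] v)]
      rw [← Finset.smul_sum, h3, smul_zero]
    rw [e2, e1 (fun y => ∑ t : Fin T, r (v :: (List.ofFn y).take t.1) (y t)), h2, ← e1]
    abel

end helpers

/-- the variance-reduced token-level estimate `ĝ₃` is unbiased, i.e.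
its expectation equals the expectation of the vanilla estimate `ĝ₁`. -/
theorem g3_estimate_unbiased
    {V : Type*} [Fintype V] [Nonempty V] {T : ℕ} (hT : 1 ≤ T)
    {Θ : Type*} [NormedAddCommGroup Θ] [NormedSpace ℝ Θ]
    (πref : List V → V → ℝ) (href_pos : ∀ p v, 0 < πref p v)
    (href_sum : ∀ p, ∑ v, πref p v = 1)
    (πθ : Θ → List V → V → ℝ)
    (hpos : ∀ θ p v, 0 < πθ θ p v) (hsum : ∀ θ p, ∑ v, πθ θ p v = 1)
    (θ₀ : Θ) (hdiff : ∀ p v, DifferentiableAt ℝ (fun θ => πθ θ p v) θ₀) :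
    (∑ y : Fin T → V, ∑ t : Fin T,
      (seqP (πθ θ₀) y *
        (Real.log (πθ θ₀ ((List.ofFn y).take t.1) (y t)
            / πref ((List.ofFn y).take t.1) (y t))
          + ∑ t' ∈ Finset.univ.filter (fun t' : Fin T => t < t'),
              KLtok (πθ θ₀ ((List.ofFn y).take t'.1)) (πref ((List.ofFn y).take t'.1)))) •
        fderiv ℝ (fun θ => Real.log (πθ θ ((List.ofFn y).take t.1) (y t))) θ₀)
    = (∑ y : Fin T → V,
      (seqP (πθ θ₀) y * Real.log (seqP (πθ θ₀) y / seqP πref y)) •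
        (∑ t : Fin T,
          fderiv ℝ (fun θ => Real.log (πθ θ ((List.ofFn y).take t.1) (y t))) θ₀)) := by
  have hs : ∀ p, ∑ v, πθ θ₀ p v • fderiv ℝ (fun θ => Real.log (πθ θ p v)) θ₀ = 0 := by
    intro p
    have h1 : ∀ v, πθ θ₀ p v • fderiv ℝ (fun θ => Real.log (πθ θ p v)) θ₀
        = fderiv ℝ (fun θ => πθ θ p v) θ₀ := by
      intro v
      rw [fderiv.log (hdiff p v) (hpos θ₀ p v).ne', smul_smul,
        mul_inv_cancel₀ (hpos θ₀ p v).ne', one_smul]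
    simp only [h1]
    rw [← fderiv_fun_sum (fun v _ => hdiff p v)]
    simp [hsum]
  have key := main_aux T (πθ θ₀) (hsum θ₀) (fun p v => Real.log (πθ θ₀ p v / πref p v))
    (fun p v => fderiv ℝ (fun θ => Real.log (πθ θ p v)) θ₀) hs
  have hlog : ∀ y : Fin T → V, Real.log (seqP (πθ θ₀) y / seqP πref y)
      = ∑ t : Fin T, Real.log (πθ θ₀ ((List.ofFn y).take t.1) (y t)
            / πref ((List.ofFn y).take t.1) (y t)) := by
    intro y
    rw [seqP, seqP, ← Finset.prod_div_distrib, Real.log_prod]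
    intro t _
    exact (div_pos (hpos _ _ _) (href_pos _ _)).ne'
  simp only [hlog, mul_smul, Finset.sum_filter, KLtok, ← Finset.smul_sum]
  exact key
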